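/- Suppose 1/δ < γ̃* < +∞ and ζ̃(c) < γ̃* for every c ∈ (0,1). Then every φ-feasible quantile function has objective value strictly less than γ̃*·x, and hence no φ-feasible quantile function attains the supremum γ̃*·x of the objective value. -/

import Mathlib

open MeasureTheory Set Filter Topology ENNReal

noncomputable section

/-- A φ-feasible quantile function for weight function `φ` and initial wealth `x`:
nondecreasing and right-continuous on `(0,1)`, with `lim_{z↓0} G(z) ≥ 0`, satisfying the
budget constraint `∫_0^1 φ(z) G(z) dz ≤ x`. -/
def FeasibleW (φ : ℝ → ℝ) (x : ℝ) (G : ℝ → ℝ) : Prop :=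
  MonotoneOn G (Set.Ioo 0 1)
  ∧ (∀ z ∈ Set.Ioo (0:ℝ) 1, Filter.Tendsto G (nhdsWithin z (Set.Ioi z)) (nhds (G z)))
  ∧ (∃ L, 0 ≤ L ∧ Filter.Tendsto G (nhdsWithin 0 (Set.Ioi 0)) (nhds L))
  ∧ ∫⁻ z in Set.Ioo (0:ℝ) 1, ENNReal.ofReal (φ z * G z) ≤ ENNReal.ofReal x

/-- The extension `Ḡ` of a (nonnegative) quantile function `G` from `(0,1)` to `[0,1]`,
valued in `[0,∞]`, with `Ḡ(0) = lim_{z↓0} G(z)` and `Ḡ(1) = lim_{z↑1} G(z)`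
(these limits are the inf/sup over `(0,1)` since `G` is nondecreasing). -/
def Gbar (G : ℝ → ℝ) : ℝ → ℝ≥0∞ := fun z =>
  if z = 0 then ⨅ y ∈ Set.Ioo (0:ℝ) 1, ENNReal.ofReal (G y)
  else if z = 1 then ⨆ y ∈ Set.Ioo (0:ℝ) 1, ENNReal.ofReal (G y)
  else ENNReal.ofReal (G z)

/-- The objective value `∫_{[0,1]} Ḡ(z) m(dz)` of a quantile function `G`
(for `m` a Borel probability measure carried by `[0,1]`). -/
def objVal (m : Measure ℝ) (G : ℝ → ℝ) : ℝ≥0∞ := ∫⁻ z, Gbar G z ∂m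

/-- `ζ̃(c) = m([c,1]) / ∫_c^1 φ(z) dz`. -/
def zetaW (φ : ℝ → ℝ) (m : Measure ℝ) (c : ℝ) : ℝ :=
  (m (Set.Icc c 1)).toReal / ∫ z in c..1, φ z

/-- If every non-null superlevel set of `f` has strictly smaller `μ`-measure than `K` times its
`ν`-measure, then the same strict comparison holds for the integrals of `f`. -/
theorem lintegral_ofReal_lt_mul_of_superlevel {α : Type*} [MeasurableSpace α] {μ ν : Measure α}
    {K : ℝ≥0∞} (hK : K ≠ ⊤) {f : α → ℝ} (hμ0 : 0 ≤ᵐ[μ] f) (hν0 : 0 ≤ᵐ[ν] f)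
    (hμm : AEMeasurable f μ) (hνm : AEMeasurable f ν)
    (hlt : ∀ t, μ {a | t < f a} ≠ 0 → μ {a | t < f a} < K * ν {a | t < f a})
    (hfin : ∫⁻ a, ENNReal.ofReal (f a) ∂ν ≠ ⊤) (hpos : ∫⁻ a, ENNReal.ofReal (f a) ∂μ ≠ 0) :
    ∫⁻ a, ENNReal.ofReal (f a) ∂μ < K * ∫⁻ a, ENNReal.ofReal (f a) ∂ν := by
  rw [lintegral_eq_lintegral_meas_lt μ hμ0 hμm] at hpos ⊢
  rw [lintegral_eq_lintegral_meas_lt ν hν0 hνm] at hfin ⊢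
  rw [← lintegral_const_mul' _ _ hK]
  have hle : ∀ t, μ {a | t < f a} ≤ K * ν {a | t < f a} := fun t => by
    by_cases h : μ {a | t < f a} = 0
    · simp [h]
    · exact (hlt t h).le
  have hfin' : ∫⁻ t in Ioi (0 : ℝ), K * ν {a | t < f a} ≠ ⊤ := by
    rw [lintegral_const_mul' _ _ hK]
    exact ENNReal.mul_ne_top hK hfin
  have hanti : Antitone fun t : ℝ => K * ν {a | t < f a} := fun s t hst =>
    mul_le_mul_right (measure_mono fun a (ha : t < f a) => hst.trans_lt ha) K
  refine (lintegral_mono hle).lt_of_not_ge fun hge => hpos ?_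
  have hae := ae_eq_of_ae_le_of_lintegral_le (ae_of_all _ hle)
    (ne_top_of_le_ne_top hfin' (lintegral_mono hle)) hanti.measurable.aemeasurable hge
  rw [lintegral_eq_zero_iff' (hanti.measurable.aemeasurable.congr hae.symm)]
  filter_upwards [hae] with t ht
  by_contra h
  exact (hlt t h).ne ht

/-- The measure on `(0,1)` with density `φ`. -/
def weightMeasure (φ : ℝ → ℝ) : Measure ℝ :=
  (volume.restrict (Ioo 0 1)).withDensity fun z => ENNReal.ofReal (φ z)

theorem weightMeasure_Ioo {φ : ℝ → ℝ} (hφpos : ∀ z ∈ Ioo (0 : ℝ) 1, 0 < φ z)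
    (hφint : IntegrableOn φ (Ioo 0 1)) {c : ℝ} (hc : c ∈ Ico (0 : ℝ) 1) :
    weightMeasure φ (Ioo c 1) = ENNReal.ofReal (∫ z in c..1, φ z) := by
  have hsub : Ioo c 1 ⊆ Ioo (0 : ℝ) 1 := Ioo_subset_Ioo_left hc.1
  rw [weightMeasure, withDensity_apply _ measurableSet_Ioo,
    Measure.restrict_restrict measurableSet_Ioo, inter_eq_left.mpr hsub,
    intervalIntegral.integral_of_le hc.2.le, integral_Ioc_eq_integral_Ioo,
    ofReal_integral_eq_lintegral_ofReal (hφint.mono_set hsub)]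
  exact ae_restrict_of_forall_mem measurableSet_Ioo fun z hz => (hφpos z (hsub hz)).le

theorem intervalIntegrable_of_integrableOn_Ioo {φ : ℝ → ℝ} (hφint : IntegrableOn φ (Ioo 0 1))
    {c : ℝ} (hc : c ∈ Ico (0 : ℝ) 1) : IntervalIntegrable φ volume c 1 := by
  rw [intervalIntegrable_iff_integrableOn_Ioo_of_le hc.2.le]
  exact hφint.mono_set (Ioo_subset_Ioo_left hc.1)

theorem tailIntegral_pos {φ : ℝ → ℝ} (hφpos : ∀ z ∈ Ioo (0 : ℝ) 1, 0 < φ z)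
    (hφint : IntegrableOn φ (Ioo 0 1)) {c : ℝ} (hc : c ∈ Ico (0 : ℝ) 1) :
    0 < ∫ z in c..1, φ z :=
  intervalIntegral.intervalIntegral_pos_of_pos_on (intervalIntegrable_of_integrableOn_Ioo hφint hc)
    (fun z hz => hφpos z ⟨hc.1.trans_lt hz.1, hz.2⟩) hc.2

/-- A bounded ratio `zetaW` forces the measure to have no atom at `1`. -/
theorem measure_singleton_one_eq_zero {φ : ℝ → ℝ} (hφpos : ∀ z ∈ Ioo (0 : ℝ) 1, 0 < φ z)
    (hφint : IntegrableOn φ (Ioo 0 1)) {m : Measure ℝ} [IsProbabilityMeasure m] {γ : ℝ}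
    (hγ : ∀ c ∈ Ioo (0 : ℝ) 1, zetaW φ m c < γ) : m {1} = 0 := by
  have hcont : Tendsto (fun c => γ * ∫ z in c..1, φ z) (𝓝[Ioo 0 1] 1) (𝓝 0) := by
    have h := intervalIntegral.continuousOn_primitive_interval_left (f := φ) (a := 0) (b := 1)
      (μ := volume) (by
        rw [uIcc_of_le zero_le_one, integrableOn_Icc_iff_integrableOn_Ioo]
        exact hφint)
    have h1 := (h 1 (by simp)).tendsto.mono_left
      (nhdsWithin_mono 1 ((Ioo_subset_Icc_self).trans Icc_subset_uIcc))
    simpa using h1.const_mul γ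
  have : (𝓝[Ioo (0 : ℝ) 1] 1).NeBot := by
    rw [← mem_closure_iff_nhdsWithin_neBot, closure_Ioo zero_ne_one]
    simp
  have hle : m.real {1} ≤ 0 := by
    refine ge_of_tendsto hcont ?_
    filter_upwards [self_mem_nhdsWithin] with c hc
    have h := hγ c hc
    rw [zetaW, div_lt_iff₀ (tailIntegral_pos hφpos hφint (Ioo_subset_Ico_self hc))] at h
    exact (measureReal_mono (singleton_subset_iff.mpr (right_mem_Icc.mpr hc.2.le))).trans h.le
  exact (measureReal_eq_zero_iff).mp (le_antisymm hle measureReal_nonneg)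

/-- Nonempty upper subsets of `[0,1)` have `m`-measure less than `γ` times their weight. -/
theorem measure_lt_mul_weightMeasure {φ : ℝ → ℝ} (hφpos : ∀ z ∈ Ioo (0 : ℝ) 1, 0 < φ z)
    (hφint : IntegrableOn φ (Ioo 0 1)) {m : Measure ℝ} [IsProbabilityMeasure m] {γ : ℝ}
    (hγ : ∀ c ∈ Ioo (0 : ℝ) 1, zetaW φ m c < γ) (hγ0 : 1 / (∫ z in (0 : ℝ)..1, φ z) < γ)
    {s : Set ℝ} (hs : s ⊆ Ico 0 1) (hne : s.Nonempty)
    (hup : ∀ a ∈ s, ∀ b ∈ Ico (0 : ℝ) 1, a ≤ b → b ∈ s) :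
    m s < ENNReal.ofReal γ * weightMeasure φ s := by
  have hbdd : BddBelow s := ⟨0, fun a ha => (hs ha).1⟩
  obtain ⟨a, ha⟩ := hne
  have hc : sInf s ∈ Ico (0 : ℝ) 1 :=
    ⟨le_csInf ⟨a, ha⟩ fun b hb => (hs hb).1, (csInf_le hbdd ha).trans_lt (hs ha).2⟩
  have hsub : s ⊆ Icc (sInf s) 1 := fun b hb => ⟨csInf_le hbdd hb, (hs hb).2.le⟩
  have hsup : Ioo (sInf s) 1 ⊆ s := fun b hb => by
    obtain ⟨d, hd, hdb⟩ := exists_lt_of_csInf_lt ⟨a, ha⟩ hb.1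
    exact hup d hd b ⟨hc.1.trans hb.1.le, hb.2⟩ hdb.le
  have hD := tailIntegral_pos hφpos hφint hc
  have hγpos : 0 < γ := (one_div_pos.mpr
    (tailIntegral_pos hφpos hφint (left_mem_Ico.mpr zero_lt_one))).trans hγ0
  have hreal : m.real s < γ * ∫ z in sInf s..1, φ z := by
    rcases hc.1.eq_or_lt with h0 | h0
    · rw [← h0] at hD ⊢
      exact measureReal_le_one.trans_lt ((div_lt_iff₀ hD).mp hγ0)
    · have h := hγ _ ⟨h0, hc.2⟩
      rw [zetaW, div_lt_iff₀ hD] at h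
      exact (measureReal_mono hsub).trans_lt h
  calc m s = ENNReal.ofReal (m.real s) := (ofReal_measureReal).symm
    _ < ENNReal.ofReal (γ * ∫ z in sInf s..1, φ z) :=
        (ENNReal.ofReal_lt_ofReal_iff (mul_pos hγpos hD)).mpr hreal
    _ = ENNReal.ofReal γ * weightMeasure φ (Ioo (sInf s) 1) := by
        rw [weightMeasure_Ioo hφpos hφint hc, ENNReal.ofReal_mul hγpos.le]
    _ ≤ ENNReal.ofReal γ * weightMeasure φ s := by gcongr

/-- Under a strict bound on the ratios, the objective stays strictly below `γ * x`. -/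
theorem objVal_lt_of_zetaW_lt {φ : ℝ → ℝ} (hφmeas : Measurable φ)
    (hφpos : ∀ z ∈ Ioo (0 : ℝ) 1, 0 < φ z) (hφint : IntegrableOn φ (Ioo 0 1)) {m : Measure ℝ}
    [IsProbabilityMeasure m] (hm : m (Icc (0 : ℝ) 1)ᶜ = 0) {x : ℝ} (hx : 0 < x) {γ : ℝ}
    (hγ : ∀ c ∈ Ioo (0 : ℝ) 1, zetaW φ m c < γ) (hγ0 : 1 / (∫ z in (0 : ℝ)..1, φ z) < γ)
    {G : ℝ → ℝ} (hG : FeasibleW φ x G) : objVal m G < ENNReal.ofReal (γ * x) := by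
  obtain ⟨hmono, -, ⟨L, hL0, hL⟩, hbudget⟩ := hG
  have hγpos : 0 < γ := (one_div_pos.mpr
    (tailIntegral_pos hφpos hφint (left_mem_Ico.mpr zero_lt_one))).trans hγ0
  have hLle : ∀ y ∈ Ioo (0 : ℝ) 1, L ≤ G y := fun y hy => by
    refine le_of_tendsto hL ?_
    filter_upwards [Ioo_mem_nhdsGT hy.1] with z hz
    exact hmono ⟨hz.1, hz.2.trans hy.2⟩ hy hz.2.le
  set H : ℝ → ℝ := fun z => if z = 0 then L else G z with hH
  have hH0 : H 0 = L := by simp [hH]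
  have hHG : ∀ z ∈ Ioo (0 : ℝ) 1, H z = G z := fun z hz => by simp [hH, hz.1.ne']
  have hHmono : MonotoneOn H (Ico 0 1) := fun a ha b hb hab => by
    rcases ha.1.eq_or_lt with rfl | ha0
    · rcases hb.1.eq_or_lt with rfl | hb0
      · exact le_rfl
      · rw [hH0, hHG b ⟨hb0, hb.2⟩]
        exact hLle b ⟨hb0, hb.2⟩
    · have hb0 := ha0.trans_le hab
      rw [hHG a ⟨ha0, ha.2⟩, hHG b ⟨hb0, hb.2⟩]
      exact hmono ⟨ha0, ha.2⟩ ⟨hb0, hb.2⟩ hab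
  have hHnn : ∀ z ∈ Ico (0 : ℝ) 1, 0 ≤ H z := fun z hz =>
    hL0.trans (hH0 ▸ hHmono (left_mem_Ico.mpr zero_lt_one) hz hz.1)
  have hac : weightMeasure φ ≪ volume.restrict (Ioo 0 1) := withDensity_absolutelyContinuous _ _
  have hmIco : ∀ᵐ z ∂m, z ∈ Ico (0 : ℝ) 1 := by
    have h1 : ∀ᵐ z ∂m, z ∈ Icc (0 : ℝ) 1 := hm
    have h2 : ∀ᵐ z ∂m, z ∉ ({1} : Set ℝ) :=
      measure_eq_zero_iff_ae_notMem.mp (measure_singleton_one_eq_zero hφpos hφint hγ)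
    filter_upwards [h1, h2] with z hz hz1
    exact ⟨hz.1, hz.2.lt_of_ne hz1⟩
  have hrestr : m.restrict (Ico 0 1) = m := Measure.restrict_eq_self_of_ae_mem hmIco
  have hobj : objVal m G ≤ ∫⁻ z, ENNReal.ofReal (H z) ∂m := by
    refine lintegral_mono_ae ?_
    filter_upwards [hmIco] with z hz
    rcases hz.1.eq_or_lt with rfl | hz0
    · rw [hH0, Gbar, if_pos rfl]
      refine ge_of_tendsto (ENNReal.tendsto_ofReal hL) ?_
      filter_upwards [Ioo_mem_nhdsGT zero_lt_one] with y hy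
      exact iInf₂_le y hy
    · rw [Gbar, if_neg hz0.ne', if_neg hz.2.ne, hHG z ⟨hz0, hz.2⟩]
  have hHm : AEMeasurable H (volume.restrict (Ioo 0 1)) :=
    aemeasurable_restrict_of_monotoneOn measurableSet_Ioo (hHmono.mono Ioo_subset_Ico_self)
  have hweight : ∫⁻ z, ENNReal.ofReal (H z) ∂weightMeasure φ ≤ ENNReal.ofReal x := by
    rw [weightMeasure, lintegral_withDensity_eq_lintegral_mul₀ hφmeas.ennreal_ofReal.aemeasurable
      hHm.ennreal_ofReal]
    refine le_trans (setLIntegral_mono' measurableSet_Ioo fun z hz => ?_) hbudget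
    rw [Pi.mul_apply, hHG z hz, ENNReal.ofReal_mul (hφpos z hz).le]
  have hνIco : ∀ᵐ z ∂weightMeasure φ, z ∈ Ico (0 : ℝ) 1 :=
    hac.ae_le (ae_restrict_of_forall_mem measurableSet_Ioo fun z hz => Ioo_subset_Ico_self hz)
  refine hobj.trans_lt ?_
  by_cases hzero : ∫⁻ z, ENNReal.ofReal (H z) ∂m = 0
  · rw [hzero]
    exact ENNReal.ofReal_pos.mpr (mul_pos hγpos hx)
  refine (lintegral_ofReal_lt_mul_of_superlevel (ν := weightMeasure φ)
    (ENNReal.ofReal_ne_top (r := γ)) (hmIco.mono hHnn) (hνIco.mono hHnn) ?_ (hHm.mono_ac hac) (fun t ht => ?_)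
    (ne_top_of_le_ne_top ENNReal.ofReal_ne_top hweight) hzero).trans_le ?_
  · rw [← hrestr]
    exact aemeasurable_restrict_of_monotoneOn measurableSet_Ico hHmono
  · have heq : m {z | t < H z} = m ({z | t < H z} ∩ Ico 0 1) := by
      rw [← Measure.restrict_apply' measurableSet_Ico, hrestr]
    rw [heq] at ht ⊢
    refine (measure_lt_mul_weightMeasure hφpos hφint hγ hγ0 inter_subset_right
      (nonempty_of_measure_ne_zero ht) fun a ha b hb hab => ?_).trans_le
      (by gcongr; exact inter_subset_left)
    exact ⟨lt_of_lt_of_le ha.1 (hHmono ha.2 hb hab), hb⟩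
  · rw [ENNReal.ofReal_mul hγpos.le]
    gcongr

/-- The step function with jump at `c` that exhausts the budget `x`. -/
def stepQuantile (φ : ℝ → ℝ) (x c : ℝ) : ℝ → ℝ :=
  fun z => if c ≤ z then x / ∫ y in c..1, φ y else 0

theorem feasibleW_stepQuantile {φ : ℝ → ℝ} (hφpos : ∀ z ∈ Ioo (0 : ℝ) 1, 0 < φ z)
    (hφint : IntegrableOn φ (Ioo 0 1)) {x : ℝ} (hx : 0 < x) {c : ℝ} (hc : c ∈ Ioo (0 : ℝ) 1) :
    FeasibleW φ x (stepQuantile φ x c) := by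
  have hc' := Ioo_subset_Ico_self hc
  have hD := tailIntegral_pos hφpos hφint hc'
  refine ⟨fun a _ b _ hab => ?_, fun z _ => ?_, ⟨0, le_rfl, ?_⟩, ?_⟩
  · have := div_nonneg hx.le hD.le
    unfold stepQuantile
    split_ifs with h1 h2
    · exact le_rfl
    · exact absurd (h1.trans hab) h2
    · exact this
    · exact le_rfl
  · refine tendsto_const_nhds.congr' ?_
    rcases le_or_gt c z with h | h
    · filter_upwards [self_mem_nhdsWithin] with y hy
      simp [stepQuantile, h, h.trans (le_of_lt hy)]
    · filter_upwards [Ioo_mem_nhdsGT h] with y hy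
      simp [stepQuantile, h.not_ge, hy.2.not_ge]
  · refine tendsto_const_nhds.congr' ?_
    filter_upwards [Ioo_mem_nhdsGT hc.1] with y hy
    simp [stepQuantile, hy.2.not_ge]
  · have hfun : ∀ z ∈ Ioo (0 : ℝ) 1, ENNReal.ofReal (φ z * stepQuantile φ x c z) =
        ENNReal.ofReal (x / ∫ y in c..1, φ y) *
          (Ici c).indicator (fun z => ENNReal.ofReal (φ z)) z := fun z hz => by
      by_cases h : c ≤ z
      · rw [stepQuantile, if_pos h, indicator_of_mem (mem_Ici.mpr h), mul_comm,
          ENNReal.ofReal_mul (div_nonneg hx.le hD.le)]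
      · simp [stepQuantile, h]
    rw [setLIntegral_congr_fun measurableSet_Ioo hfun,
      lintegral_const_mul' _ _ ENNReal.ofReal_ne_top, lintegral_indicator measurableSet_Ici,
      ← withDensity_apply _ measurableSet_Ici, ← weightMeasure]
    have hIci : weightMeasure φ (Ici c) = weightMeasure φ (Ioo c 1) := by
      refine measure_congr ?_
      have hac : weightMeasure φ ≪ volume.restrict (Ioo 0 1) :=
        withDensity_absolutelyContinuous _ _
      have hne : ∀ᵐ z ∂volume.restrict (Ioo (0 : ℝ) 1), z ≠ c := Measure.ae_ne _ c
      refine eventuallyEq_set.mpr (hac.ae_le ?_)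
      filter_upwards [ae_restrict_mem measurableSet_Ioo, hne] with z hz hzc
      exact ⟨fun h => ⟨lt_of_le_of_ne h hzc.symm, hz.2⟩, fun h => h.1.le⟩
    rw [hIci, weightMeasure_Ioo hφpos hφint hc', ← ENNReal.ofReal_mul (div_nonneg hx.le hD.le),
      div_mul_cancel₀ _ hD.ne']

theorem zetaW_mul_le_objVal_stepQuantile {φ : ℝ → ℝ} (hφpos : ∀ z ∈ Ioo (0 : ℝ) 1, 0 < φ z)
    (hφint : IntegrableOn φ (Ioo 0 1)) {m : Measure ℝ} [IsProbabilityMeasure m]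
    {x : ℝ} (hx : 0 < x) {c : ℝ} (hc : c ∈ Ioo (0 : ℝ) 1) :
    ENNReal.ofReal (zetaW φ m c * x) ≤ objVal m (stepQuantile φ x c) := by
  have hD := tailIntegral_pos hφpos hφint (Ioo_subset_Ico_self hc)
  have heq : zetaW φ m c * x = (x / ∫ y in c..1, φ y) * m.real (Icc c 1) := by
    rw [zetaW, measureReal_def]
    ring
  rw [heq, ENNReal.ofReal_mul (div_nonneg hx.le hD.le), ofReal_measureReal,
    ← lintegral_indicator_const measurableSet_Icc]
  refine lintegral_mono fun z => indicator_le' (fun z hz => ?_) (fun _ _ => zero_le) z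
  have hz0 : z ≠ 0 := (hc.1.trans_le hz.1).ne'
  rw [Gbar, if_neg hz0]
  split_ifs with h1
  · refine le_trans ?_ (le_iSup₂ c hc)
    simp [stepQuantile]
  · rw [stepQuantile, if_pos hz.1]

/-- if `1/δ < γ̃* < +∞` and `ζ̃(c) < γ̃*` for every `c ∈ (0,1)`, then every
φ-feasible quantile function has objective value strictly less than `γ̃*·x`; `γ̃*·x` is
the supremum of the objective value, hence no φ-feasible quantile function attains it. -/
theorem no_optimal_of_not_attained_phi
    (φ : ℝ → ℝ) (hφmeas : Measurable φ) (hφpos : ∀ z ∈ Set.Ioo (0:ℝ) 1, 0 < φ z)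
    (hφint : IntegrableOn φ (Set.Ioo 0 1))
    (δ : ℝ) (hδ : δ = ∫ z in (0:ℝ)..1, φ z) (hδpos : 0 < δ)
    (m : Measure ℝ) [IsProbabilityMeasure m] (hm : m (Set.Icc (0:ℝ) 1)ᶜ = 0)
    (x : ℝ) (hx : 0 < x)
    (γstar : ℝ) (hlub : IsLUB (zetaW φ m '' Set.Ioo 0 1) γstar)
    (hgt : 1 / δ < γstar)
    (hna : ∀ c ∈ Set.Ioo (0:ℝ) 1, zetaW φ m c < γstar) :
    (∀ G : ℝ → ℝ, FeasibleW φ x G → objVal m G < ENNReal.ofReal (γstar * x))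
    ∧ (⨆ (G : ℝ → ℝ) (_ : FeasibleW φ x G), objVal m G) = ENNReal.ofReal (γstar * x)
    ∧ ¬ ∃ G : ℝ → ℝ, FeasibleW φ x G ∧ objVal m G = ENNReal.ofReal (γstar * x) := by
  subst hδ
  have hlt : ∀ G : ℝ → ℝ, FeasibleW φ x G → objVal m G < ENNReal.ofReal (γstar * x) :=
    fun G hG => objVal_lt_of_zetaW_lt hφmeas hφpos hφint hm hx hna hgt hG
  refine ⟨hlt, le_antisymm (iSup₂_le fun G hG => (hlt G hG).le) ?_,
    fun ⟨G, hG, heq⟩ => (hlt G hG).ne heq⟩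
  set S := ⨆ (G : ℝ → ℝ) (_ : FeasibleW φ x G), objVal m G with hS
  by_cases htop : S = ⊤
  · simp [htop]
  refine ENNReal.ofReal_le_of_le_toReal ((le_div_iff₀ hx).mp (hlub.2 ?_))
  rintro _ ⟨c, hc, rfl⟩
  rw [le_div_iff₀ hx, ← ENNReal.ofReal_le_iff_le_toReal htop]
  exact (zetaW_mul_le_objVal_stepQuantile hφpos hφint hx hc).trans
    (le_iSup₂_of_le _ (feasibleW_stepQuantile hφpos hφint hx hc) le_rfl)
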